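/- For any non-degenerate continuum K ⊆ ℝ^d and any ε > 0 there exists a rectifiable curve Γ (the image of a Lipschitz map from a compact real interval) such that the Hausdorff dimension of Γ ∩ K is at least 1 − ε. -/

import Mathlib

/-- **Boundary bumping**: inside a compact preconnected set `L`, the connected component of `x` in
`L ∩ closedBall x r` reaches the sphere of radius `r`, provided `L` is not contained in the open
ball. -/
theorem IsPreconnected.exists_subset_closedBall {X : Type*} [MetricSpace X] {L : Set X}
    (hL : IsPreconnected L) (hc : IsCompact L) {x y : X} {r : ℝ} (hr : 0 < r) (hx : x ∈ L)
    (hy : y ∈ L) (hxy : r ≤ dist y x) :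
    ∃ M ⊆ L, M ⊆ Metric.closedBall x r ∧ IsCompact M ∧ IsPreconnected M ∧ x ∈ M ∧
      ∃ z ∈ M, r ≤ dist z x := by
  set A : Set X := L ∩ Metric.closedBall x r with hA
  have hAc : IsCompact A := hc.inter_right Metric.isClosed_closedBall
  have : CompactSpace A := isCompact_iff_compactSpace.mp hAc
  have hxA : x ∈ A := ⟨hx, Metric.mem_closedBall_self hr.le⟩
  let x' : A := ⟨x, hxA⟩
  refine ⟨Subtype.val '' connectedComponent x', ?_, ?_,
    isClosed_connectedComponent.isCompact.image continuous_subtype_val,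
    isPreconnected_connectedComponent.image _ continuous_subtype_val.continuousOn,
    ⟨x', mem_connectedComponent, rfl⟩, ?_⟩
  · rintro _ ⟨a, -, rfl⟩
    exact a.2.1
  · rintro _ ⟨a, -, rfl⟩
    exact a.2.2
  by_contra! hlt
  have : Nonempty {s : Set A // IsClopen s ∧ x' ∈ s} := ⟨⟨Set.univ, isClopen_univ, trivial⟩⟩
  obtain ⟨⟨V, hV, hxV⟩, hVsub⟩ := exists_subset_nhds_of_isCompact
    (V := fun s : {s : Set A // IsClopen s ∧ x' ∈ s} => (s : Set A))
    (U := {a : A | dist (a : X) x < r})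
    (fun s t => ⟨⟨s.1 ∩ t.1, s.2.1.inter t.2.1, s.2.2, t.2.2⟩,
      Set.inter_subset_left, Set.inter_subset_right⟩)
    (fun s => s.2.1.1.isCompact)
    (fun a ha => by
      rw [← connectedComponent_eq_iInter_isClopen] at ha
      exact (isOpen_lt (by fun_prop) continuous_const).mem_nhds (hlt a ⟨a, ha, rfl⟩))
  obtain ⟨O, hO, rfl⟩ := isOpen_induced_iff.mp hV.2
  obtain ⟨z, hzL, ⟨hzO, hzb⟩, hzS⟩ := hL (O ∩ Metric.ball x r)
    (Subtype.val '' (Subtype.val ⁻¹' O : Set A))ᶜ (hO.inter Metric.isOpen_ball)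
    (hV.1.isCompact.image continuous_subtype_val).isClosed.isOpen_compl
    (fun z _ => by
      by_cases hz : z ∈ Subtype.val '' (Subtype.val ⁻¹' O : Set A)
      · obtain ⟨a, ha, rfl⟩ := hz
        exact Or.inl ⟨ha, hVsub ha⟩
      · exact Or.inr hz)
    ⟨x, hx, hxV, Metric.mem_ball_self hr⟩
    ⟨y, hy, by
      rintro ⟨a, ha, rfl⟩
      exact absurd (hVsub ha) (not_lt.mpr hxy)⟩
  exact hzS ⟨⟨z, hzL, Metric.ball_subset_closedBall hzb⟩, hzO, rfl⟩

/-- A compact preconnected set `p.2` containing `p.1`, contained in the closed ball of radius `r`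
about `p.1` and reaching its boundary. -/
structure IsSpanningPiece {X : Type*} [MetricSpace X] (r : ℝ) (p : X × Set X) : Prop where
  isCompact : IsCompact p.2
  isPreconnected : IsPreconnected p.2
  center_mem : p.1 ∈ p.2
  subset_closedBall : p.2 ⊆ Metric.closedBall p.1 r
  exists_le_dist : ∃ z ∈ p.2, r ≤ dist z p.1

/-- A spanning piece of radius `r` contains `N` well separated spanning pieces of radius
`r / (4 * N)`. -/
theorem IsSpanningPiece.exists_children {X : Type*} [MetricSpace X] {r : ℝ} {p : X × Set X}
    (hp : IsSpanningPiece r p) (hr : 0 < r) {N : ℕ} (hN : 0 < N) :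
    ∃ q : Fin N → X × Set X, (∀ i, IsSpanningPiece (r / (4 * N)) (q i) ∧ (q i).2 ⊆ p.2) ∧
      ∀ i j, i ≠ j → ∀ a ∈ (q i).2, ∀ b ∈ (q j).2, 2 * r / (4 * N) ≤ dist a b := by
  obtain ⟨hc, hconn, hmem, -, z, hz, hzr⟩ := hp
  have hN1 : (1 : ℝ) ≤ N := by exact_mod_cast hN
  have hpt (i : Fin N) : ∃ x ∈ p.2, dist x p.1 = i * (r / N) := by
    have hiN : (i : ℝ) ≤ N := by exact_mod_cast i.2.le
    refine hconn.intermediate_value hmem hz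
      (f := fun x => dist x p.1) (by fun_prop) ⟨by simp only [dist_self]; positivity, ?_⟩
    calc (i : ℝ) * (r / N) ≤ N * (r / N) := by gcongr
      _ = r := by field_simp
      _ ≤ _ := hzr
  choose x hxp hx using hpt
  have hρ : r / (4 * N) ≤ r / 4 := by
    gcongr
    linarith
  have hfar (i : Fin N) : ∃ y ∈ p.2, r / (4 * N) ≤ dist y (x i) := by
    by_contra! h
    have h₁ := h _ hmem
    have h₂ := h _ hz
    have := dist_triangle_right z p.1 (x i)
    linarith
  choose y hy hyx using hfar
  choose M hMp hMb hMc hMconn hxM hMfar using fun i =>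
    hconn.exists_subset_closedBall hc (by positivity : 0 < r / (4 * N)) (hxp i) (hy i) (hyx i)
  refine ⟨fun i => (x i, M i), fun i => ⟨⟨hMc i, hMconn i, hxM i, hMb i, hMfar i⟩, hMp i⟩, ?_⟩
  intro i j hij a ha b hb
  have hai : dist a (x i) ≤ r / (4 * N) := hMb i ha
  have hbj : dist b (x j) ≤ r / (4 * N) := hMb j hb
  have hsep : r / N ≤ dist (x i) (x j) := by
    refine le_trans ?_ (abs_dist_sub_le (x i) (x j) p.1)
    rw [hx, hx, ← sub_mul, abs_mul, abs_of_pos (by positivity : 0 < r / N)]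
    refine le_mul_of_one_le_left (by positivity) ?_
    have : (1 : ℤ) ≤ |(i : ℤ) - j| := Int.one_le_abs (by
      have := Fin.val_ne_of_ne hij
      lia)
    exact_mod_cast this
  have h4 : dist (x i) (x j) ≤ dist a (x i) + dist a b + dist b (x j) := by
    have h₁ := dist_triangle_left (x i) (x j) a
    have h₂ := dist_triangle a b (x j)
    linarith
  have hrN : r / N = 4 * (r / (4 * N)) := by field_simp
  have : 2 * r / (4 * N) = 2 * (r / (4 * N)) := by ring
  linarith

/-- A nondegenerate spanning piece contains a self-similar Cantor set coded by sequences of `N`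
digits, with scaling ratio `1 / (4 * N)`. -/
theorem IsSpanningPiece.exists_coding {X : Type*} [MetricSpace X] {r : ℝ} {p : X × Set X}
    (hp : IsSpanningPiece r p) (hr : 0 < r) {N : ℕ} (hN : 0 < N) :
    ∃ π : (ℕ → Fin N) → X, (∀ σ, π σ ∈ p.2) ∧ ∀ σ τ n, (∀ i < n, σ i = τ i) → σ n ≠ τ n →
      dist (π σ) (π τ) ≤ 2 * r / (4 * N) ^ n ∧ 2 * r / (4 * N) ^ (n + 1) ≤ dist (π σ) (π τ) := by
  have hN' : (0 : ℝ) < N := by exact_mod_cast hN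
  have hchild (n : ℕ) (q : X × Set X) : ∃ c : Fin N → X × Set X,
      IsSpanningPiece (r / (4 * N) ^ n) q →
      (∀ i, IsSpanningPiece (r / (4 * N) ^ (n + 1)) (c i) ∧ (c i).2 ⊆ q.2) ∧
      ∀ i j, i ≠ j → ∀ a ∈ (c i).2, ∀ b ∈ (c j).2, 2 * r / (4 * N) ^ (n + 1) ≤ dist a b := by
    by_cases h : IsSpanningPiece (r / (4 * N) ^ n) q
    · obtain ⟨c, hc, hsep⟩ := h.exists_children (by positivity) hN
      simp only [← mul_div_assoc, div_div, ← pow_succ] at hc hsep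
      exact ⟨c, fun _ => ⟨hc, hsep⟩⟩
    · exact ⟨fun _ => q, fun h' => absurd h' h⟩
  choose c hc using hchild
  let P (σ : ℕ → Fin N) (n : ℕ) : X × Set X := Nat.rec p (fun n q => c n q (σ n)) n
  have hP (σ : ℕ → Fin N) (n : ℕ) : IsSpanningPiece (r / (4 * N) ^ n) (P σ n) := by
    induction n with
    | zero => simpa [P] using hp
    | succ n ih => exact ((hc n (P σ n) ih).1 (σ n)).1
  have hanti (σ : ℕ → Fin N) (n : ℕ) : (P σ (n + 1)).2 ⊆ (P σ n).2 :=
    ((hc n (P σ n) (hP σ n)).1 (σ n)).2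
  have hcongr (σ τ : ℕ → Fin N) (n : ℕ) (h : ∀ i < n, σ i = τ i) : P σ n = P τ n := by
    induction n with
    | zero => rfl
    | succ n ih =>
      change c n (P σ n) (σ n) = c n (P τ n) (τ n)
      rw [ih fun i hi => h i (by lia), h n (by lia)]
  have hne (σ : ℕ → Fin N) : (⋂ n, (P σ n).2).Nonempty :=
    IsCompact.nonempty_iInter_of_sequence_nonempty_isCompact_isClosed _ (hanti σ)
      (fun n => ⟨_, (hP σ n).center_mem⟩) (hP σ 0).isCompact
      fun n => (hP σ n).isCompact.isClosed
  choose π hπ using hne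
  simp only [Set.mem_iInter] at hπ
  refine ⟨π, fun σ => hπ σ 0, fun σ τ n h hn => ⟨?_, ?_⟩⟩
  · have h₁ := (hP σ n).subset_closedBall (hπ σ n)
    have h₂ := (hP σ n).subset_closedBall (hcongr σ τ n h ▸ hπ τ n)
    rw [Metric.mem_closedBall] at h₁ h₂
    have := dist_triangle_right (π σ) (π τ) (P σ n).1
    rw [mul_div_assoc]
    linarith
  · refine (hc n (P σ n) (hP σ n)).2 (σ n) (τ n) hn _ (hπ σ (n + 1)) _ ?_
    rw [hcongr σ τ n h]
    exact hπ τ (n + 1)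

/-- If two sequences of digits at most `N - 1` first differ at index `n`, then the numbers they
represent in base `4 * N` are at distance comparable to `(4 * N) ^ (-n)`. -/
theorem Real.le_abs_ofDigits_castLE_sub {N : ℕ} {σ τ : ℕ → Fin N} {n : ℕ}
    (h : ∀ i < n, σ i = τ i) (hn : σ n ≠ τ n) :
    1 / (2 * (4 * N : ℝ) ^ (n + 1)) ≤
      |Real.ofDigits (fun i => (σ i).castLE (by lia : N ≤ 4 * N)) -
        Real.ofDigits (fun i => (τ i).castLE (by lia : N ≤ 4 * N))| := by
  have hN : 0 < N := (σ 0).pos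
  have hN1 : (1 : ℝ) ≤ N := by exact_mod_cast hN
  have key (σ : ℕ → Fin N) (n : ℕ) :
      0 ≤ Real.ofDigits (fun i => (σ (i + n)).castLE (by lia : N ≤ 4 * N)) ∧
      Real.ofDigits (fun i => (σ (i + n)).castLE (by lia : N ≤ 4 * N)) ≤ 1 / 4 := by
    refine ⟨Real.ofDigits_nonneg _, ?_⟩
    rw [Real.ofDigits_eq_sum_add_ofDigits _ 1]
    have h₁ := Real.ofDigits_le_one (fun i => (σ (i + 1 + n)).castLE (by lia : N ≤ 4 * N))
    have h₂ : ((σ (0 + n) : ℕ) : ℝ) + 1 ≤ N := by exact_mod_cast (σ (0 + n)).2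
    simp only [Finset.sum_range_one, Real.ofDigitsTerm, Fin.val_castLE, zero_add, pow_one] at h₂ ⊢
    push_cast
    calc ((σ n : ℕ) : ℝ) * (4 * N : ℝ)⁻¹ + (4 * N : ℝ)⁻¹ *
          Real.ofDigits (fun i => (σ (i + 1 + n)).castLE (by lia : N ≤ 4 * N))
        ≤ ((σ n : ℕ) : ℝ) * (4 * N : ℝ)⁻¹ + (4 * N : ℝ)⁻¹ * 1 := by gcongr
      _ = (((σ n : ℕ) : ℝ) + 1) * (4 * N : ℝ)⁻¹ := by ring
      _ ≤ N * (4 * N : ℝ)⁻¹ := by gcongr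
      _ = 1 / 4 := by field_simp
  rw [Real.ofDigits_eq_sum_add_ofDigits _ (n + 1),
    Real.ofDigits_eq_sum_add_ofDigits (fun i => (τ i).castLE _) (n + 1),
    Finset.sum_range_succ, Finset.sum_range_succ]
  have hsum : ∑ i ∈ Finset.range n,
      Real.ofDigitsTerm (fun i => (σ i).castLE (by lia : N ≤ 4 * N)) i =
      ∑ i ∈ Finset.range n, Real.ofDigitsTerm (fun i => (τ i).castLE (by lia : N ≤ 4 * N)) i :=
    Finset.sum_congr rfl fun i hi => by
      simp only [Real.ofDigitsTerm, h i (Finset.mem_range.mp hi)]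
  obtain ⟨hs₀, hs₁⟩ := key σ (n + 1)
  obtain ⟨ht₀, ht₁⟩ := key τ (n + 1)
  have hd : (1 : ℝ) ≤ |((σ n : ℕ) : ℝ) - (τ n : ℕ)| := by
    have : (1 : ℤ) ≤ |((σ n : ℕ) : ℤ) - (τ n : ℕ)| := Int.one_le_abs (by
      have := Fin.val_ne_of_ne hn
      lia)
    exact_mod_cast this
  rw [hsum]
  simp only [Real.ofDigitsTerm, Fin.val_castLE]
  push_cast
  generalize Real.ofDigits (fun i => (σ (i + (n + 1))).castLE (by lia : N ≤ 4 * N)) = s at *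
  generalize Real.ofDigits (fun i => (τ (i + (n + 1))).castLE (by lia : N ≤ 4 * N)) = t at *
  have hB : 0 < ((4 * N : ℝ) ^ (n + 1))⁻¹ := by positivity
  have hst : |s - t| ≤ 1 / 4 := abs_le.mpr ⟨by linarith, by linarith⟩
  have htri := abs_sub_abs_le_abs_sub (((σ n : ℕ) : ℝ) - (τ n : ℕ)) (t - s)
  rw [abs_sub_comm t s] at htri
  calc 1 / (2 * (4 * N : ℝ) ^ (n + 1)) = ((4 * N : ℝ) ^ (n + 1))⁻¹ * (1 / 2) := by field_simp
    _ ≤ ((4 * N : ℝ) ^ (n + 1))⁻¹ * |((σ n : ℕ) : ℝ) - (τ n : ℕ) - (t - s)| := by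
      gcongr
      linarith
    _ = |((4 * N : ℝ) ^ (n + 1))⁻¹ * (((σ n : ℕ) : ℝ) - (τ n : ℕ) - (t - s))| := by
      rw [abs_mul, abs_of_pos hB]
    _ = _ := by
      congr 1
      ring

/-- A space coded by infinite `N`-ary words, with cylinders of length `n` separated at scale
`B ^ (-n)`, has Hausdorff dimension at least `s`, where `N = B ^ s`. -/
theorem le_dimH_range_of_coding {X : Type*} [MetricSpace X] {N : ℕ} (hN : 1 < N)
    {B c : ℝ} {s : NNReal} (hB : 0 < B) (hc : 0 < c) (hs : 0 < s) (hBs : B ^ (s : ℝ) = N)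
    {π : (ℕ → Fin N) → X}
    (hπ : ∀ σ τ n, (∀ i < n, σ i = τ i) → σ n ≠ τ n → c / B ^ n ≤ dist (π σ) (π τ)) :
    (s : ENNReal) ≤ dimH (Set.range π) := by
  have hdist (σ τ : ℕ → Fin N) :
      dist (Real.ofDigits σ) (Real.ofDigits τ) ≤ (1 / c) ^ (s : ℝ) * dist (π σ) (π τ) ^ (s : ℝ) := by
    by_cases hστ : σ = τ
    · subst hστ
      rw [dist_self]
      positivity
    set n := PiNat.firstDiff σ τ
    have hlt : ∀ i < n, σ i = τ i := fun i hi => PiNat.apply_eq_of_lt_firstDiff hi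
    have h := hπ σ τ n hlt (PiNat.apply_firstDiff_ne hστ)
    rw [Real.dist_eq, ← Real.mul_rpow (by positivity) dist_nonneg]
    calc _ ≤ ((N : ℝ) ^ n)⁻¹ := Real.abs_ofDigits_sub_ofDigits_le hlt
      _ = ((B ^ n)⁻¹) ^ (s : ℝ) := by
        rw [Real.inv_rpow (by positivity), ← hBs, Real.rpow_pow_comm hB.le]
      _ ≤ _ := by
        refine Real.rpow_le_rpow (by positivity) ?_ s.2
        calc (B ^ n)⁻¹ = 1 / c * (c / B ^ n) := by field_simp
          _ ≤ _ := by gcongr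
  have hinj : Function.Injective π := fun σ τ h => by
    by_contra hστ
    have := hπ σ τ _ (fun i hi => PiNat.apply_eq_of_lt_firstDiff hi)
      (PiNat.apply_firstDiff_ne hστ)
    rw [h, dist_self] at this
    exact absurd this (not_le.mpr (by positivity))
  have : Nonempty (ℕ → Fin N) := ⟨fun _ => ⟨0, by lia⟩⟩
  have hleft : Function.LeftInverse (Function.invFun π) π := Function.leftInverse_invFun hinj
  have hholder : HolderOnWith (Real.toNNReal ((1 / c) ^ (s : ℝ))) s
      (Real.ofDigits ∘ Function.invFun π) (Set.range π) := by
    rintro _ ⟨σ, rfl⟩ _ ⟨τ, rfl⟩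
    simp only [Function.comp_apply, hleft σ, hleft τ]
    rw [edist_dist, edist_dist, ENNReal.ofReal_rpow_of_nonneg dist_nonneg s.coe_nonneg,
      ← ENNReal.ofReal, ← ENNReal.ofReal_mul (by positivity)]
    exact ENNReal.ofReal_le_ofReal (hdist σ τ)
  have himage : Set.Icc (0 : ℝ) 1 ⊆ (Real.ofDigits ∘ Function.invFun π) '' Set.range π := by
    intro x hx
    obtain ⟨σ, -, rfl⟩ := Real.ofDigits_SurjOn hN hx
    exact ⟨π σ, ⟨σ, rfl⟩, by simp [hleft σ]⟩
  have hone : dimH (Set.Icc (0 : ℝ) 1) = 1 := by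
    simpa using Real.dimH_of_nonempty_interior (s := Set.Icc (0 : ℝ) 1) (by simp)
  have h := (dimH_mono himage).trans (hholder.dimH_image_le hs)
  rw [hone, ENNReal.le_div_iff_mul_le (by simp [hs.ne']) (by simp)] at h
  simpa using h

/-- A set coded by infinite `N`-ary words, with cylinders of length `n` of diameter at most
`c * (4 * N) ^ (-n)`, lies on a Lipschitz curve. -/
theorem exists_lipschitzWith_range_subset_image_Icc {E : Type*} [NormedAddCommGroup E]
    [NormedSpace ℝ E] [FiniteDimensional ℝ E] {N : ℕ} (hN : 0 < N) {c : ℝ} (hc : 0 < c)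
    {π : (ℕ → Fin N) → E}
    (hπ : ∀ σ τ n, (∀ i < n, σ i = τ i) → σ n ≠ τ n → dist (π σ) (π τ) ≤ c / (4 * N) ^ n) :
    ∃ (f : ℝ → E) (C : NNReal), LipschitzWith C f ∧ Set.range π ⊆ f '' Set.Icc 0 1 := by
  let γ (σ : ℕ → Fin N) : ℝ := Real.ofDigits (fun i => (σ i).castLE (by lia : N ≤ 4 * N))
  have hN' : (0 : ℝ) < N := by exact_mod_cast hN
  have hγ (σ τ : ℕ → Fin N) (h : σ ≠ τ) :
      1 / (2 * (4 * N : ℝ) ^ (PiNat.firstDiff σ τ + 1)) ≤ |γ σ - γ τ| :=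
    Real.le_abs_ofDigits_castLE_sub (fun i hi => PiNat.apply_eq_of_lt_firstDiff hi)
      (PiNat.apply_firstDiff_ne h)
  have hinj : Function.Injective γ := fun σ τ h => by
    by_contra hστ
    have := hγ σ τ hστ
    rw [h, sub_self, abs_zero] at this
    exact absurd this (not_le.mpr (by positivity))
  have : Nonempty (ℕ → Fin N) := ⟨fun _ => ⟨0, hN⟩⟩
  have hleft : Function.LeftInverse (Function.invFun γ) γ := Function.leftInverse_invFun hinj
  have hlip : LipschitzOnWith (Real.toNNReal (c * (8 * N))) (π ∘ Function.invFun γ)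
      (Set.range γ) := by
    refine LipschitzOnWith.of_dist_le_mul ?_
    rintro _ ⟨σ, rfl⟩ _ ⟨τ, rfl⟩
    simp only [Function.comp_apply, hleft σ, hleft τ]
    rw [Real.coe_toNNReal _ (by positivity)]
    by_cases hστ : σ = τ
    · simp [hστ]
    refine (hπ σ τ _ (fun i hi => PiNat.apply_eq_of_lt_firstDiff hi)
      (PiNat.apply_firstDiff_ne hστ)).trans ?_
    calc c / (4 * N : ℝ) ^ PiNat.firstDiff σ τ
        = c * (8 * N) * (1 / (2 * (4 * N : ℝ) ^ (PiNat.firstDiff σ τ + 1))) := by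
          rw [pow_succ]
          field_simp
          norm_num
      _ ≤ _ := by
        gcongr
        exact hγ σ τ hστ
  obtain ⟨f, hf, hfeq⟩ := hlip.extend_finite_dimension
  refine ⟨f, _, hf, ?_⟩
  rintro _ ⟨σ, rfl⟩
  refine ⟨γ σ, ⟨Real.ofDigits_nonneg _, Real.ofDigits_le_one _⟩, ?_⟩
  rw [← hfeq ⟨σ, rfl⟩, Function.comp_apply, hleft σ]

open MeasureTheory

/-- For any non-degenerate continuum `K ⊆ ℝ^d` and any `ε > 0` there exists a rectifiable
curve (the image of a Lipschitz map from a compact real interval) such that the Hausdorff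
dimension of its intersection with `K` is at least `1 - ε`. -/
theorem rectifiable_curve_inter_continuum_dimH_ge
    (d : ℕ) (K : Set (EuclideanSpace ℝ (Fin d)))
    (hKcomp : IsCompact K) (hKconn : IsConnected K) (hKnt : K.Nontrivial)
    (ε : ℝ) (hε : 0 < ε) :
    ∃ (a b : ℝ) (f : ℝ → EuclideanSpace ℝ (Fin d)) (C : NNReal),
      a ≤ b ∧ LipschitzOnWith C f (Set.Icc a b) ∧
      ENNReal.ofReal (1 - ε) ≤ dimH (f '' Set.Icc a b ∩ K) := by
  obtain ⟨x, hx, y, hy, hxy⟩ := hKnt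
  have hr : 0 < dist y x := dist_pos.mpr hxy.symm
  obtain ⟨M, hMK, hMb, hMc, hMconn, hxM, hMfar⟩ :=
    hKconn.isPreconnected.exists_subset_closedBall hKcomp hr hx hy le_rfl
  have hpiece : IsSpanningPiece (dist y x) (x, M) := ⟨hMc, hMconn, hxM, hMb, hMfar⟩
  obtain ⟨m, hm⟩ := exists_nat_gt (1 / ε)
  have hm0 : (0 : ℝ) < m := lt_trans (by positivity) hm
  have hm1 : m ≠ 0 := by
    rintro rfl
    simp at hm0
  let N : ℕ := 4 ^ m
  have hN : 1 < N := Nat.one_lt_pow hm1 (by norm_num)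
  have hN' : (0 : ℝ) < N := by positivity
  obtain ⟨π, hπM, hπ⟩ := hpiece.exists_coding hr (by lia : 0 < N)
  obtain ⟨f, C, hf, hπf⟩ := exists_lipschitzWith_range_subset_image_Icc (by lia : 0 < N)
    (by positivity : 0 < 2 * dist y x) fun σ τ n h hn => (hπ σ τ n h hn).1
  let s : NNReal := m / (m + 1)
  have hs : (s : ℝ) = m / (m + 1) := by simp [s]
  have hBs : (4 * N : ℝ) ^ (s : ℝ) = N := by
    have : (4 * N : ℝ) = (4 : ℝ) ^ ((m : ℝ) + 1) := by
      rw [Real.rpow_add_one (by norm_num), Real.rpow_natCast]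
      simp [N, mul_comm]
    rw [this, ← Real.rpow_mul (by norm_num), hs, mul_div_cancel₀ _ (by positivity),
      Real.rpow_natCast]
    simp [N]
  have hdim : (s : ENNReal) ≤ dimH (Set.range π) := by
    refine le_dimH_range_of_coding hN (by positivity : (0 : ℝ) < 4 * N)
      (by positivity : 0 < 2 * dist y x / (4 * N)) ?_ hBs fun σ τ n h hn => ?_
    · rw [← NNReal.coe_pos, hs]
      positivity
    · rw [div_div, ← pow_succ']
      exact (hπ σ τ n h hn).2
  refine ⟨0, 1, f, C, zero_le_one, hf.lipschitzOnWith, ?_⟩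
  calc ENNReal.ofReal (1 - ε) ≤ ENNReal.ofReal s := by
        refine ENNReal.ofReal_le_ofReal ?_
        rw [hs, le_div_iff₀ (by positivity)]
        rw [div_lt_iff₀ hε] at hm
        nlinarith
    _ = s := ENNReal.ofReal_coe_nnreal
    _ ≤ dimH (Set.range π) := hdim
    _ ≤ _ := dimH_mono (Set.subset_inter hπf (by
        rintro _ ⟨σ, rfl⟩
        exact hMK (hπM σ)))
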